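/- Let c be a real constant and define Ω_{νμ} = ∫_{-1}^{1} P_ν(τ) · (P_μ(τ) + c · s_μ(τ)) dτ for natural numbers ν, μ. Then Ω_{νμ} = 0 whenever |ν − μ| > 1; that is, the matrix Ω arising from the spectral discretization of the operator d/dτ + c in the basis {s_μ} projected onto {P_ν} is tridiagonal. -/

import Mathlib

open Polynomial

/-- The Legendre polynomial of the first kind, via the Rodrigues formula
`P_n(x) = 1/(2^n · n!) · dⁿ/dxⁿ [(x² − 1)ⁿ]`. -/
noncomputable def legendre (n : ℕ) : Polynomial ℝ :=
  Polynomial.C ((2 ^ n * (n.factorial : ℝ))⁻¹) *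
    (Polynomial.derivative^[n] ((Polynomial.X ^ 2 - 1) ^ n))

/-- The Legendre polynomial as a real function. -/
noncomputable def legP (n : ℕ) (x : ℝ) : ℝ := (legendre n).eval x

/-- `s_μ(τ) = ∫_{-1}^{τ} P_μ(t) dt`. -/
noncomputable def legS (μ : ℕ) (τ : ℝ) : ℝ := ∫ t in (-1 : ℝ)..τ, legP μ t

/-- Derivatives of `(X² - 1)ⁿ` of order less than `n` vanish at the roots of `X² - 1`. -/
theorem eval_iterate_derivative_sq_sub_one_pow {n k : ℕ} (hk : k < n) {x : ℝ}
    (hx : x ^ 2 - 1 = 0) : (derivative^[k] ((X ^ 2 - 1 : ℝ[X]) ^ n)).eval x = 0 := by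
  have hd := pow_sub_dvd_iterate_derivative_of_pow_dvd k
    (dvd_refl ((X ^ 2 - 1 : ℝ[X]) ^ n))
  have h1 : (X ^ 2 - 1 : ℝ[X]) ∣ derivative^[k] ((X ^ 2 - 1 : ℝ[X]) ^ n) :=
    (dvd_pow_self _ (Nat.sub_ne_zero_of_lt hk)).trans hd
  obtain ⟨r, hr⟩ := h1
  rw [hr]
  simp [hx]

/-- A polynomial killed by `m` derivatives is orthogonal on `[-1, 1]` to the `m`-th derivative of
`(X² - 1)ⁿ`, for `m ≤ n`. -/
theorem integral_eval_mul_iterate_derivative_eq_zero {n m : ℕ} (hm : m ≤ n) (q : ℝ[X])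
    (hq : derivative^[m] q = 0) :
    ∫ x in (-1 : ℝ)..1, q.eval x * (derivative^[m] ((X ^ 2 - 1 : ℝ[X]) ^ n)).eval x = 0 := by
  induction m generalizing q with
  | zero =>
    have h0 : q = 0 := hq
    simp [h0]
  | succ m ih =>
    rw [Function.iterate_succ_apply] at hq
    rw [Function.iterate_succ_apply', intervalIntegral.integral_mul_deriv_eq_deriv_mul
      (fun x _ => q.hasDerivAt x) (fun x _ => Polynomial.hasDerivAt _ x)
      ((Polynomial.continuous _).intervalIntegrable _ _)
      ((Polynomial.continuous _).intervalIntegrable _ _), ih (by omega) _ hq,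
      eval_iterate_derivative_sq_sub_one_pow hm (by norm_num),
      eval_iterate_derivative_sq_sub_one_pow hm (by norm_num)]
    simp

theorem integral_eval_mul_legP_eq_zero {n : ℕ} (q : ℝ[X]) (hq : derivative^[n] q = 0) :
    ∫ x in (-1 : ℝ)..1, q.eval x * legP n x = 0 := by
  simp only [legP, legendre, eval_mul, eval_C, mul_left_comm (eval _ q)]
  rw [intervalIntegral.integral_const_mul,
    integral_eval_mul_iterate_derivative_eq_zero le_rfl q hq, mul_zero]

theorem iterate_derivative_legendre_eq_zero {n k : ℕ} (h : n < k) :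
    derivative^[k] (legendre n) = 0 := by
  apply iterate_derivative_eq_zero
  refine lt_of_le_of_lt ?_ h
  refine (natDegree_C_mul_le _ _).trans ((natDegree_iterate_derivative _ n).trans ?_)
  have hw : ((X ^ 2 - 1 : ℝ[X]) ^ n).natDegree ≤ n * 2 :=
    natDegree_pow_le_of_le n (by compute_degree)
  omega

theorem legS_eq_eval {n : ℕ} {Q : ℝ[X]} (hQ : derivative Q = legendre n) (h0 : Q.eval (-1) = 0)
    (x : ℝ) : legS n x = Q.eval x := by
  unfold legS legP
  rw [← hQ, intervalIntegral.integral_eq_sub_of_hasDerivAt (fun t _ => Q.hasDerivAt t)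
    ((Polynomial.continuous _).intervalIntegrable _ _), h0, sub_zero]

theorem derivative_C_mul_iterate_derivative_eq_legendre (n : ℕ) :
    derivative (C ((2 ^ (n + 1) * ((n + 1).factorial : ℝ))⁻¹) *
      derivative^[n] ((X ^ 2 - 1 : ℝ[X]) ^ (n + 1))) = legendre (n + 1) := by
  rw [derivative_C_mul, legendre, Function.iterate_succ_apply']

theorem legS_succ (n : ℕ) (x : ℝ) :
    legS (n + 1) x = (2 ^ (n + 1) * ((n + 1).factorial : ℝ))⁻¹ *
      (derivative^[n] ((X ^ 2 - 1 : ℝ[X]) ^ (n + 1))).eval x := by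
  rw [legS_eq_eval (derivative_C_mul_iterate_derivative_eq_legendre n), eval_mul, eval_C]
  rw [eval_mul, eval_iterate_derivative_sq_sub_one_pow n.lt_succ_self (by norm_num), mul_zero]

theorem exists_antiderivative_legendre (n : ℕ) :
    ∃ Q : ℝ[X], derivative Q = legendre n ∧ Q.eval (-1) = 0 := by
  cases n with
  | zero => exact ⟨X + 1, by simp [legendre], by simp⟩
  | succ n =>
    refine ⟨_, derivative_C_mul_iterate_derivative_eq_legendre n, ?_⟩
    rw [eval_mul, eval_iterate_derivative_sq_sub_one_pow n.lt_succ_self (by norm_num), mul_zero]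

/-- The spectral matrix `Ω_{νμ} = ∫_{-1}^{1} P_ν(τ)·(P_μ(τ) + c·s_μ(τ)) dτ` of the
operator `d/dτ + c` in the basis `{s_μ}` projected onto `{P_ν}` is tridiagonal:
`Ω_{νμ} = 0` whenever `|ν − μ| > 1`. -/
theorem spectral_matrix_tridiagonal (c : ℝ) (ν μ : ℕ) (h : 1 < |(ν : ℤ) - (μ : ℤ)|) :
    ∫ τ in (-1 : ℝ)..1, legP ν τ * (legP μ τ + c * legS μ τ) = 0 := by
  obtain ⟨Q, hQ, hQ0⟩ := exists_antiderivative_legendre μ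
  rcases lt_or_ge (μ + 1) ν with hlt | hge
  · have hq : derivative^[ν] (legendre μ + C c * Q) = 0 := by
      obtain ⟨k, rfl⟩ : ∃ k, ν = k + 1 := ⟨ν - 1, by omega⟩
      rw [iterate_map_add, iterate_derivative_C_mul, Function.iterate_succ_apply _ _ Q, hQ,
        iterate_derivative_legendre_eq_zero (by omega),
        iterate_derivative_legendre_eq_zero (by omega), mul_zero, add_zero]
    rw [← integral_eval_mul_legP_eq_zero _ hq]
    congr 1 with x
    rw [legS_eq_eval hQ hQ0, eval_add, eval_mul, eval_C, mul_comm, legP, legP]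
  · have hlt : ν + 1 < μ := by
      rcases lt_abs.mp h with h | h <;> omega
    obtain ⟨m, rfl⟩ : ∃ m, μ = m + 1 := ⟨μ - 1, by omega⟩
    have hP := integral_eval_mul_legP_eq_zero (n := m + 1) (legendre ν)
      (iterate_derivative_legendre_eq_zero (by omega))
    have hS := integral_eval_mul_iterate_derivative_eq_zero m.le_succ (legendre ν)
      (iterate_derivative_legendre_eq_zero (by omega))
    simp only [mul_add, legS_succ, mul_left_comm (legP ν _)]
    rw [intervalIntegral.integral_add]
    · rw [intervalIntegral.integral_const_mul, intervalIntegral.integral_const_mul]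
      unfold legP at hP ⊢
      rw [hP, hS]
      simp
    all_goals
      apply Continuous.intervalIntegrable
      unfold legP
      fun_prop
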